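/- arXiv:1111.1613 — 2 statements merged into one kernel-verified Lean document; each statement's English description precedes it below -/
import Mathlib

section
/- Let n ≥ 2 and let F : ℝ^{n+1} → ℝ^{n+1} be a causal automorphism of (n+1)-dimensional Minkowski spacetime which is also a smooth diffeomorphism, with components y_1, …, y_{n+1}. Then ∂y_{n+1}/∂x_{n+1} > 0 at every point, and for every smooth function ψ : ℝ^{n+1} → ℝ, □(ψ∘F) = 0 on ℝ^{n+1} if and only if □ψ = 0 on ℝ^{n+1}. -/
open scoped BigOperators
open Matrix

noncomputable section

/-- Sign vector of the Minkowski metric: `+1` for the first `n` coordinates, `-1` for the last. -/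
def eps (n : ℕ) (i : Fin (n + 1)) : ℝ := if i = Fin.last n then -1 else 1

/-- The Minkowski bilinear form `η(u,v) = Σ_{i<n} u_i v_i − u_n v_n` on `ℝ^{n+1}`. -/
def eta (n : ℕ) (u v : Fin (n + 1) → ℝ) : ℝ := ∑ i, eps n i * u i * v i

/-- Partial derivative in the `i`-th coordinate direction. -/
def pd (n : ℕ) (f : (Fin (n + 1) → ℝ) → ℝ) (i : Fin (n + 1)) (x : Fin (n + 1) → ℝ) : ℝ :=
  fderiv ℝ f x (Pi.single i 1)

/-- The wave operator `□φ = Σ_{i=1}^n ∂²φ/∂x_i² − ∂²φ/∂x_{n+1}²`. -/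
def waveOp (n : ℕ) (f : (Fin (n + 1) → ℝ) → ℝ) (x : Fin (n + 1) → ℝ) : ℝ :=
  ∑ i, eps n i * pd n (pd n f i) i x

/-- The causal order on Minkowski space: `x ≤ y` iff `y − x` is causal and future-pointing. -/
def causalLe (n : ℕ) (x y : Fin (n + 1) → ℝ) : Prop :=
  eta n (y - x) (y - x) ≤ 0 ∧ x (Fin.last n) ≤ y (Fin.last n)

/-- A causal automorphism: a bijection preserving the causal order in both directions. -/
def IsCausalAuto (n : ℕ) (F : (Fin (n + 1) → ℝ) → (Fin (n + 1) → ℝ)) : Prop :=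
  Function.Bijective F ∧ ∀ x y, causalLe n x y ↔ causalLe n (F x) (F y)

/-- The matrix `η = diag(1, …, 1, −1)`. -/
def etaM (n : ℕ) : Matrix (Fin (n + 1)) (Fin (n + 1)) ℝ := Matrix.diagonal (eps n)

/-- A Lorentz matrix: `Aᵀ η A = η`. -/
def IsLorentz (n : ℕ) (A : Matrix (Fin (n + 1)) (Fin (n + 1)) ℝ) : Prop :=
  Aᵀ * etaM n * A = etaM n

/-- The `i`-th row of the Jacobian of `F` at `x`. -/
def jacRow (n : ℕ) (F : (Fin (n + 1) → ℝ) → (Fin (n + 1) → ℝ)) (i : Fin (n + 1))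
    (x : Fin (n + 1) → ℝ) : Fin (n + 1) → ℝ :=
  fun j => pd n (fun z => F z i) j x

section Eta

variable {n : ℕ}

lemma eta_comm (u v : Fin (n + 1) → ℝ) : eta n u v = eta n v u :=
  Finset.sum_congr rfl fun _ _ => by ring

lemma eta_add_left (u v w : Fin (n + 1) → ℝ) : eta n (u + v) w = eta n u w + eta n v w := by
  simp only [eta, ← Finset.sum_add_distrib, Pi.add_apply]
  exact Finset.sum_congr rfl fun _ _ => by ring

lemma eta_smul_left (c : ℝ) (u w : Fin (n + 1) → ℝ) : eta n (c • u) w = c * eta n u w := by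
  simp only [eta, Finset.mul_sum, Pi.smul_apply, smul_eq_mul]
  exact Finset.sum_congr rfl fun _ _ => by ring

lemma eta_add_right (u v w : Fin (n + 1) → ℝ) : eta n u (v + w) = eta n u v + eta n u w := by
  rw [eta_comm, eta_add_left, eta_comm v, eta_comm w]

lemma eta_smul_right (c : ℝ) (u w : Fin (n + 1) → ℝ) : eta n u (c • w) = c * eta n u w := by
  rw [eta_comm, eta_smul_left, eta_comm]

lemma eta_neg_left (u w : Fin (n + 1) → ℝ) : eta n (-u) w = -eta n u w := by
  rw [← neg_one_smul ℝ u, eta_smul_left]; ring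

lemma eta_neg_right (u w : Fin (n + 1) → ℝ) : eta n u (-w) = -eta n u w := by
  rw [eta_comm, eta_neg_left, eta_comm]

lemma eta_sub_left (u v w : Fin (n + 1) → ℝ) : eta n (u - v) w = eta n u w - eta n v w := by
  rw [sub_eq_add_neg, eta_add_left, eta_neg_left]; ring

lemma eta_sub_right (u v w : Fin (n + 1) → ℝ) : eta n u (v - w) = eta n u v - eta n u w := by
  rw [sub_eq_add_neg, eta_add_right, eta_neg_right]; ring

lemma eta_zero_left (w : Fin (n + 1) → ℝ) : eta n 0 w = 0 := by simp [eta]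

lemma eta_sub_self_comm (u v : Fin (n + 1) → ℝ) :
    eta n (u - v) (u - v) = eta n (v - u) (v - u) := by
  rw [← neg_sub, eta_neg_left, eta_neg_right, neg_neg]

lemma eta_eq_sum_sub (u v : Fin (n + 1) → ℝ) :
    eta n u v = ∑ i : Fin n, u i.castSucc * v i.castSucc - u (Fin.last n) * v (Fin.last n) := by
  simp [eta, Fin.sum_univ_castSucc, eps, Fin.castSucc_ne_last]
  ring

lemma eta_single_right (u : Fin (n + 1) → ℝ) (i : Fin (n + 1)) :
    eta n u (Pi.single i 1) = eps n i * u i := by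
  simp [eta, Pi.single_apply]

lemma eta_single_single (i j : Fin (n + 1)) :
    eta n (Pi.single i 1) (Pi.single j 1) = if i = j then eps n i else 0 := by
  rw [eta_single_right]
  rcases eq_or_ne i j with rfl | h
  · simp
  · simp [h, h.symm]

lemma eps_last : eps n (Fin.last n) = -1 := by simp [eps]

lemma eps_castSucc (i : Fin n) : eps n i.castSucc = 1 := by simp [eps, Fin.castSucc_ne_last]

lemma eta_sub_sub_self (u v : Fin (n + 1) → ℝ) :
    eta n (u - v) (u - v) = eta n u u - 2 * eta n u v + eta n v v := by
  rw [eta_sub_left, eta_sub_right, eta_sub_right, eta_comm v u]; ring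

lemma continuous_eta_self : Continuous fun u : Fin (n + 1) → ℝ => eta n u u := by
  unfold eta; fun_prop

/-- A causal vector with vanishing time component is zero. -/
lemma eq_zero_of_eta_self_nonpos {w : Fin (n + 1) → ℝ} (h : eta n w w ≤ 0)
    (hl : w (Fin.last n) = 0) : w = 0 := by
  rw [eta_eq_sum_sub, hl] at h
  have h0 : ∑ i : Fin n, w i.castSucc * w i.castSucc = 0 :=
    le_antisymm (by linarith) (Finset.sum_nonneg fun _ _ => mul_self_nonneg _)
  rw [Finset.sum_eq_zero_iff_of_nonneg fun _ _ => mul_self_nonneg _] at h0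
  ext i
  refine Fin.lastCases hl (fun j => ?_) i
  simpa using h0 j (Finset.mem_univ j)

/-- Orthogonal null vectors are parallel. -/
lemma exists_eq_smul_of_null {u v : Fin (n + 1) → ℝ} (hu : eta n u u = 0) (hv : eta n v v = 0)
    (huv : eta n u v = 0) (hu0 : u ≠ 0) : ∃ c : ℝ, v = c • u := by
  have hl : u (Fin.last n) ≠ 0 := fun h => hu0 (eq_zero_of_eta_self_nonpos hu.le h)
  refine ⟨v (Fin.last n) / u (Fin.last n), sub_eq_zero.mp (eq_zero_of_eta_self_nonpos ?_ ?_)⟩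
  · simp [eta_sub_left, eta_sub_right, eta_smul_left, eta_smul_right, hu, hv, huv, eta_comm v u]
  · simp [hl]

end Eta

section Homeomorph

variable {n : ℕ} {Φ : (Fin (n + 1) → ℝ) ≃ₜ (Fin (n + 1) → ℝ)}

lemma causalLe_symm (h : ∀ x y, causalLe n x y ↔ causalLe n (Φ x) (Φ y)) (x y : Fin (n + 1) → ℝ) :
    causalLe n x y ↔ causalLe n (Φ.symm x) (Φ.symm y) := by
  simp [h (Φ.symm x)]

lemma eta_map_eq_zero_of_causalLe (h : ∀ x y, causalLe n x y ↔ causalLe n (Φ x) (Φ y))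
    {x y : Fin (n + 1) → ℝ} (hle : causalLe n x y) (hxy : eta n (y - x) (y - x) = 0) :
    eta n (Φ y - Φ x) (Φ y - Φ x) = 0 := by
  by_contra hne
  have hle' := (h x y).1 hle
  have hneg : eta n (Φ y - Φ x) (Φ y - Φ x) < 0 := lt_of_le_of_ne hle'.1 hne
  have hlast : Φ x (Fin.last n) < Φ y (Fin.last n) := by
    refine lt_of_le_of_ne hle'.2 fun he => hne ?_
    rw [eq_zero_of_eta_self_nonpos hle'.1 (by simp [he]), eta_zero_left]
  have hpos : x (Fin.last n) < y (Fin.last n) := by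
    refine lt_of_le_of_ne hle.2 fun he => hne ?_
    have := sub_eq_zero.1 (eq_zero_of_eta_self_nonpos hle.1 (by simp [he]))
    rw [this, sub_self, eta_zero_left]
  let γ : ℝ → Fin (n + 1) → ℝ := fun t => Φ (y - t • Pi.single (Fin.last n) 1)
  have hγ : Continuous γ := Φ.continuous.comp (by fun_prop)
  have hγ0 : γ 0 = Φ y := by simp [γ]
  have h1 : ∀ᶠ t in nhds (0 : ℝ), eta n (γ t - Φ x) (γ t - Φ x) < 0 :=
    (continuous_eta_self.comp (hγ.sub continuous_const)).continuousAt.eventually_lt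
      continuousAt_const (by simpa [hγ0] using hneg)
  have h2 : ∀ᶠ t in nhds (0 : ℝ), Φ x (Fin.last n) < γ t (Fin.last n) :=
    continuousAt_const.eventually_lt
      ((continuous_apply (Fin.last n)).comp hγ).continuousAt (by simpa [hγ0] using hlast)
  have h3 : ∀ᶠ t in nhds (0 : ℝ), t < y (Fin.last n) - x (Fin.last n) :=
    eventually_lt_nhds (by linarith)
  obtain ⟨t, ⟨h1, h2, h3⟩, ht⟩ :=
    (((h1.and (h2.and h3)).filter_mono nhdsWithin_le_nhds).and
      (self_mem_nhdsWithin : Set.Ioi (0 : ℝ) ∈ nhdsWithin 0 (Set.Ioi 0))).exists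
  have hc := ((h x _).2 ⟨h1.le, h2.le⟩).1
  rw [sub_right_comm] at hc
  simp only [eta_sub_sub_self _ (_ • _), eta_smul_right, hxy, eta_single_right, eps_last,
    Pi.single_eq_same, Pi.smul_apply, Pi.sub_apply, smul_eq_mul] at hc
  have ht : 0 < t := ht
  nlinarith

/-- A causal automorphism preserves null separation. -/
lemma eta_map_eq_zero (h : ∀ x y, causalLe n x y ↔ causalLe n (Φ x) (Φ y))
    {x y : Fin (n + 1) → ℝ} (hxy : eta n (y - x) (y - x) = 0) :
    eta n (Φ y - Φ x) (Φ y - Φ x) = 0 := by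
  rcases le_total (x (Fin.last n)) (y (Fin.last n)) with hl | hl
  · exact eta_map_eq_zero_of_causalLe h ⟨hxy.le, hl⟩ hxy
  · rw [eta_sub_self_comm] at hxy ⊢
    exact eta_map_eq_zero_of_causalLe h ⟨hxy.le, hl⟩ hxy

lemma eta_map_eq_zero_iff (h : ∀ x y, causalLe n x y ↔ causalLe n (Φ x) (Φ y))
    {x y : Fin (n + 1) → ℝ} :
    eta n (Φ y - Φ x) (Φ y - Φ x) = 0 ↔ eta n (y - x) (y - x) = 0 :=
  ⟨fun hxy => by simpa using eta_map_eq_zero (causalLe_symm h) hxy, eta_map_eq_zero h⟩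

lemma map_add_sub_ne_zero {v : Fin (n + 1) → ℝ} (hv0 : v ≠ 0) (x : Fin (n + 1) → ℝ) :
    Φ (x + v) - Φ x ≠ 0 := by
  simpa [sub_eq_zero] using hv0

/-- A causal automorphism maps null lines into null lines. -/
lemma exists_map_add_smul (h : ∀ x y, causalLe n x y ↔ causalLe n (Φ x) (Φ y))
    {v : Fin (n + 1) → ℝ} (hv : eta n v v = 0) (hv0 : v ≠ 0) (x : Fin (n + 1) → ℝ) (t : ℝ) :
    ∃ c : ℝ, Φ (x + t • v) = Φ x + c • (Φ (x + v) - Φ x) := by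
  have ha : eta n (Φ (x + v) - Φ x) (Φ (x + v) - Φ x) = 0 := eta_map_eq_zero h (by simpa using hv)
  have hb : eta n (Φ (x + t • v) - Φ x) (Φ (x + t • v) - Φ x) = 0 :=
    eta_map_eq_zero h (by simp [eta_smul_left, eta_smul_right, hv])
  have hab : eta n (Φ (x + v) - Φ (x + t • v)) (Φ (x + v) - Φ (x + t • v)) = 0 := by
    refine eta_map_eq_zero h ?_
    rw [show x + v - (x + t • v) = (1 - t) • v by module]
    simp [eta_smul_left, eta_smul_right, hv]
  rw [← sub_sub_sub_cancel_right _ _ (Φ x), eta_sub_sub_self (_ - _), ha, hb] at hab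
  obtain ⟨c, hc⟩ := exists_eq_smul_of_null ha hb (by linarith) (map_add_sub_ne_zero hv0 x)
  exact ⟨c, by rw [← hc]; abel⟩

/-- The image of a null line under a causal automorphism is a whole null line. -/
lemma exists_map_add_smul_eq (h : ∀ x y, causalLe n x y ↔ causalLe n (Φ x) (Φ y))
    {v : Fin (n + 1) → ℝ} (hv : eta n v v = 0) (hv0 : v ≠ 0) (x : Fin (n + 1) → ℝ) (c : ℝ) :
    ∃ t : ℝ, Φ (x + t • v) = Φ x + c • (Φ (x + v) - Φ x) := by
  obtain ⟨t, ht⟩ := exists_map_add_smul (causalLe_symm h)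
    (eta_map_eq_zero (x := x) (y := x + v) h (by simpa using hv)) (map_add_sub_ne_zero hv0 x) (Φ x) c
  refine ⟨t, ?_⟩
  rw [add_sub_cancel, Φ.symm_apply_apply, Φ.symm_apply_apply, add_sub_cancel_left] at ht
  rw [← ht, Φ.apply_symm_apply]

/-- Parallel null lines in general position have parallel images. -/
lemma eta_map_add_sub_eq_zero (h : ∀ x y, causalLe n x y ↔ causalLe n (Φ x) (Φ y))
    {v : Fin (n + 1) → ℝ} (hv : eta n v v = 0) {p q : Fin (n + 1) → ℝ}
    (hpq : eta n (q - p) v ≠ 0) :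
    eta n (Φ (p + v) - Φ p) (Φ (q + v) - Φ q) = 0 := by
  by_contra hκ
  have hv0 : v ≠ 0 := by
    rintro rfl
    exact hpq (by rw [eta_comm, eta_zero_left])
  have hz : eta n (Φ (q + v) - Φ q) (Φ (q + v) - Φ q) = 0 := eta_map_eq_zero h (by simpa using hv)
  obtain ⟨t, ht⟩ := exists_map_add_smul_eq h hv hv0 p
    (eta n (Φ q - Φ p) (Φ (q + v) - Φ q) / eta n (Φ (p + v) - Φ p) (Φ (q + v) - Φ q))
  have horth : eta n (Φ q - Φ (p + t • v)) (Φ (q + v) - Φ q) = 0 := by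
    rw [ht, ← sub_sub, eta_sub_left, eta_smul_left, div_mul_cancel₀ _ hκ, sub_self]
  have hsep : ∀ s : ℝ, eta n (Φ (q + s • v) - Φ (p + t • v)) (Φ (q + s • v) - Φ (p + t • v)) =
      eta n (Φ q - Φ (p + t • v)) (Φ q - Φ (p + t • v)) := by
    intro s
    obtain ⟨d, hd⟩ := exists_map_add_smul h hv hv0 q s
    rw [hd, add_sub_right_comm]
    simp only [eta_add_left (Φ q - Φ (p + t • v)), eta_add_right _ (Φ q - Φ (p + t • v)),
      eta_smul_left, eta_smul_right, horth, hz, eta_comm _ (Φ q - Φ (p + t • v))]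
    ring
  have hsrc : ∀ s : ℝ, eta n (q + s • v - (p + t • v)) (q + s • v - (p + t • v)) =
      eta n (q - p) (q - p) + 2 * (s - t) * eta n (q - p) v := by
    intro s
    rw [show q + s • v - (p + t • v) = (q - p) + (s - t) • v by module]
    simp only [eta_add_left (q - p), eta_add_right _ (q - p), eta_smul_left, eta_smul_right, hv,
      eta_comm v]
    ring
  have hnull : eta n (Φ q - Φ (p + t • v)) (Φ q - Φ (p + t • v)) = 0 := by
    rw [← hsep (t - eta n (q - p) (q - p) / (2 * eta n (q - p) v)), eta_map_eq_zero_iff h, hsrc]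
    field_simp
    ring
  have h0 := hsrc t
  have h1 := hsrc (t + 1)
  rw [(eta_map_eq_zero_iff h).1 ((hsep _).trans hnull)] at h0 h1
  exact hpq (by linarith)

lemma map_add_add_sub_of_null (h : ∀ x y, causalLe n x y ↔ causalLe n (Φ x) (Φ y))
    {u v : Fin (n + 1) → ℝ} (hu : eta n u u = 0) (hv : eta n v v = 0) (huv : eta n u v ≠ 0)
    (x : Fin (n + 1) → ℝ) : Φ (x + u + v) - Φ (x + u) = Φ (x + v) - Φ x := by
  have hu0 : u ≠ 0 := by
    rintro rfl
    exact huv (eta_zero_left _)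
  have hv0 : v ≠ 0 := by
    rintro rfl
    exact huv (by rw [eta_comm, eta_zero_left])
  have ha : eta n (Φ (x + v) - Φ x) (Φ (x + v) - Φ x) = 0 := eta_map_eq_zero h (by simpa using hv)
  have hb : eta n (Φ (x + u) - Φ x) (Φ (x + u) - Φ x) = 0 := eta_map_eq_zero h (by simpa using hu)
  have ha' : eta n (Φ (x + u + v) - Φ (x + u)) (Φ (x + u + v) - Φ (x + u)) = 0 :=
    eta_map_eq_zero h (by simpa using hv)
  have hb' : eta n (Φ (x + v + u) - Φ (x + v)) (Φ (x + v + u) - Φ (x + v)) = 0 :=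
    eta_map_eq_zero h (by simpa using hu)
  obtain ⟨k, hk⟩ := exists_eq_smul_of_null ha ha'
    (eta_map_add_sub_eq_zero h hv (by simpa using huv)) (map_add_sub_ne_zero hv0 x)
  obtain ⟨l, hl⟩ := exists_eq_smul_of_null hb hb'
    (eta_map_add_sub_eq_zero h hu (by simpa [eta_comm v] using huv)) (map_add_sub_ne_zero hu0 x)
  have hab : eta n (Φ (x + v) - Φ x) (Φ (x + u) - Φ x) ≠ 0 := by
    intro h0
    have hnull : eta n (Φ (x + v) - Φ (x + u)) (Φ (x + v) - Φ (x + u)) = 0 := by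
      rw [← sub_sub_sub_cancel_right _ _ (Φ x), eta_sub_sub_self (_ - _), ha, hb, h0]
      ring
    rw [eta_map_eq_zero_iff h, add_sub_add_left_eq_sub, eta_sub_sub_self, hu, hv, eta_comm v]
      at hnull
    exact huv (by linarith)
  have hsum : (Φ (x + v) - Φ x) + l • (Φ (x + u) - Φ x) =
      (Φ (x + u) - Φ x) + k • (Φ (x + v) - Φ x) := by
    rw [← hk, ← hl, add_right_comm x v u]
    abel
  have hpair := congrArg (fun w => eta n w (Φ (x + u) - Φ x)) hsum
  simp only [eta_add_left (Φ (x + v) - Φ x), eta_add_left (Φ (x + u) - Φ x), eta_smul_left, hb]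
    at hpair
  have hk1 : k = 1 := mul_right_cancel₀ hab (by linarith)
  rw [hk, hk1, one_smul]

end Homeomorph

section Span

variable {n : ℕ}

lemma eq_top_of_smul_single_mem (H : AddSubgroup (Fin (n + 1) → ℝ))
    (hH : ∀ (i : Fin (n + 1)) (c : ℝ), c • Pi.single i (1 : ℝ) ∈ H) : H = ⊤ := by
  refine eq_top_iff.2 fun x _ => ?_
  rw [pi_eq_sum_univ' x]
  exact H.sum_mem fun i _ => hH i (x i)

lemma null_single_last_add (σ : ℝ) (hσ : σ * σ = 1) (c : ℝ) (i : Fin n) :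
    eta n (c • (Pi.single (Fin.last n) 1 + σ • Pi.single i.castSucc 1))
      (c • (Pi.single (Fin.last n) 1 + σ • Pi.single i.castSucc 1)) = 0 := by
  simp [eta_smul_left, eta_smul_right, eta_add_left, eta_add_right, eta_single_single, eps_last,
    eps_castSucc, Fin.castSucc_ne_last, (Fin.castSucc_ne_last _).symm]
  linear_combination c * c * hσ

lemma eta_single_last_add (σ c : ℝ) (i : Fin n) (v : Fin (n + 1) → ℝ) :
    eta n (c • (Pi.single (Fin.last n) 1 + σ • Pi.single i.castSucc 1)) v =
      c * (σ * v i.castSucc - v (Fin.last n)) := by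
  rw [eta_smul_left, eta_add_left, eta_smul_left, eta_comm, eta_single_right, eta_comm,
    eta_single_right, eps_last, eps_castSucc]
  ring

/-- In spatial dimension at least two, the null vectors not parallel to a given one span. -/
lemma eq_top_of_null_mem (hn : 2 ≤ n) {v : Fin (n + 1) → ℝ} (hv : eta n v v = 0) (hv0 : v ≠ 0)
    (H : AddSubgroup (Fin (n + 1) → ℝ))
    (hH : ∀ u, eta n u u = 0 → eta n u v ≠ 0 → u ∈ H) : H = ⊤ := by
  have hl : v (Fin.last n) ≠ 0 := fun h => hv0 (eq_zero_of_eta_self_nonpos hv.le h)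
  have hmem : ∀ (σ : ℝ) (i : Fin n), σ * σ = 1 → σ * v i.castSucc - v (Fin.last n) ≠ 0 →
      ∀ c : ℝ, c • (Pi.single (Fin.last n) (1 : ℝ) + σ • Pi.single i.castSucc 1) ∈ H := by
    intro σ i hσ hi c
    rcases eq_or_ne c 0 with rfl | hc
    · simp
    · exact hH _ (null_single_last_add σ hσ c i)
        (by rw [eta_single_last_add]; exact mul_ne_zero hc hi)
  have hlast : ∀ c : ℝ, c • Pi.single (Fin.last n) (1 : ℝ) ∈ H := by
    obtain ⟨j, hj⟩ : ∃ j : Fin n, v j.castSucc * v j.castSucc ≠ v (Fin.last n) * v (Fin.last n) := by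
      by_contra! hall
      rw [eta_eq_sum_sub, Finset.sum_congr rfl fun j _ => hall j] at hv
      simp only [Finset.sum_const, Finset.card_univ, Fintype.card_fin, nsmul_eq_mul] at hv
      have hn' : (2 : ℝ) ≤ n := by exact_mod_cast hn
      nlinarith [mul_self_pos.2 hl]
    intro c
    have h1 := hmem 1 j (by norm_num) (fun h => hj (by
      rw [show v j.castSucc = v (Fin.last n) by linarith])) (c / 2)
    have h2 := hmem (-1) j (by norm_num) (fun h => hj (by
      rw [show v j.castSucc = -v (Fin.last n) by linarith]; ring)) (c / 2)
    convert H.add_mem h1 h2 using 1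
    module
  refine eq_top_of_smul_single_mem H fun i => Fin.lastCases hlast (fun i c => ?_) i
  by_cases h1 : 1 * v i.castSucc - v (Fin.last n) = 0
  · have h2 := hmem (-1) i (by norm_num) (fun h => hl (by linarith)) c
    convert H.sub_mem (hlast c) h2 using 1
    module
  · convert H.sub_mem (hmem 1 i (by norm_num) h1 c) (hlast c) using 1
    module

end Span

section Affine

variable {n : ℕ} {Φ : (Fin (n + 1) → ℝ) ≃ₜ (Fin (n + 1) → ℝ)}

lemma map_add_add_sub_of_null_right (hn : 2 ≤ n)
    (h : ∀ x y, causalLe n x y ↔ causalLe n (Φ x) (Φ y))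
    {v : Fin (n + 1) → ℝ} (hv : eta n v v = 0) (x u : Fin (n + 1) → ℝ) :
    Φ (x + u + v) - Φ (x + u) = Φ (x + v) - Φ x := by
  rcases eq_or_ne v 0 with rfl | hv0
  · simp
  let H : AddSubgroup (Fin (n + 1) → ℝ) :=
    { carrier := {u | ∀ x, Φ (x + u + v) - Φ (x + u) = Φ (x + v) - Φ x}
      zero_mem' := fun x => by simp
      add_mem' := fun {a b} ha hb x => by rw [← add_assoc, hb (x + a), ha x]
      neg_mem' := fun {a} ha x => by simpa using (ha (x + -a)).symm }
  have hH : H = ⊤ := eq_top_of_null_mem hn hv hv0 H fun u hu huv =>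
    map_add_add_sub_of_null h hu hv huv
  exact (hH ▸ AddSubgroup.mem_top u : u ∈ H) x

lemma map_add_add_sub (hn : 2 ≤ n) (h : ∀ x y, causalLe n x y ↔ causalLe n (Φ x) (Φ y))
    (x u v : Fin (n + 1) → ℝ) : Φ (x + u + v) - Φ (x + u) = Φ (x + v) - Φ x := by
  let H : AddSubgroup (Fin (n + 1) → ℝ) :=
    { carrier := {v | ∀ x u, Φ (x + u + v) - Φ (x + u) = Φ (x + v) - Φ x}
      zero_mem' := fun x u => by simp
      add_mem' := fun {a b} ha hb x u => by
        have h1 := ha x u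
        have h2 := hb (x + a) u
        rw [add_right_comm x a u] at h2
        rw [← add_assoc, ← add_assoc, ← sub_add_sub_cancel _ (Φ (x + u + a)), h1, h2]
        abel
      neg_mem' := fun {a} ha x u => by
        have h1 := ha (x + -a) u
        rw [add_right_comm x (-a) u] at h1
        simp only [neg_add_cancel_right] at h1
        rw [← neg_sub, h1, neg_sub] }
  have hH : H = ⊤ := by
    have hv0 : (Pi.single (Fin.last n) 1 + Pi.single (Fin.castSucc ⟨0, by omega⟩) 1 :
        Fin (n + 1) → ℝ) ≠ 0 := fun h0 => by
      simpa [Pi.single_apply, show n ≠ 0 by omega] using congrFun h0 (Fin.last n)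
    have hv := null_single_last_add (n := n) 1 (by norm_num) 1 ⟨0, by omega⟩
    rw [one_smul, one_smul] at hv
    exact eq_top_of_null_mem hn hv hv0 H fun u hu _ x w => map_add_add_sub_of_null_right hn h hu x w
  exact (hH ▸ AddSubgroup.mem_top v : v ∈ H) x u

/-- A causal automorphism in spatial dimension at least two is affine. -/
lemma exists_affine (hn : 2 ≤ n) (h : ∀ x y, causalLe n x y ↔ causalLe n (Φ x) (Φ y)) :
    ∃ L : (Fin (n + 1) → ℝ) →L[ℝ] (Fin (n + 1) → ℝ), ∀ x, Φ x = L x + Φ 0 := by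
  let f : (Fin (n + 1) → ℝ) →+ (Fin (n + 1) → ℝ) :=
    { toFun := fun x => Φ x - Φ 0
      map_zero' := sub_self _
      map_add' := fun u v => by
        have := map_add_add_sub hn h 0 u v
        simp only [zero_add] at this
        rw [← this]
        abel }
  have hf : Continuous f := Φ.continuous.sub continuous_const
  exact ⟨f.toRealLinearMap hf, fun x => (sub_add_cancel (Φ x) (Φ 0)).symm⟩

end Affine

section Conformal

variable {n : ℕ}

/-- A linear map preserving the null cone is conformal. -/
lemma eta_map_single (L : (Fin (n + 1) → ℝ) →L[ℝ] (Fin (n + 1) → ℝ))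
    (hL : ∀ v, eta n v v = 0 → eta n (L v) (L v) = 0) (i j : Fin (n + 1)) :
    eta n (L (Pi.single i 1)) (L (Pi.single j 1)) =
      -eta n (L (Pi.single (Fin.last n) 1)) (L (Pi.single (Fin.last n) 1)) *
        (if i = j then eps n i else 0) := by
  have hM : ∀ k : Fin n,
      eta n (L (Pi.single k.castSucc 1)) (L (Pi.single k.castSucc 1)) =
        -eta n (L (Pi.single (Fin.last n) 1)) (L (Pi.single (Fin.last n) 1)) ∧
      eta n (L (Pi.single k.castSucc 1)) (L (Pi.single (Fin.last n) 1)) = 0 := by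
    intro k
    have h1 := hL _ (null_single_last_add 1 (by norm_num) 1 k)
    have h2 := hL _ (null_single_last_add (-1) (by norm_num) 1 k)
    simp only [one_smul, map_add, map_smul, eta_add_left, eta_add_right, eta_smul_left,
      eta_smul_right, eta_comm (L (Pi.single (Fin.last n) 1)) (L (Pi.single k.castSucc 1))] at h1 h2
    constructor <;> linarith
  induction i using Fin.lastCases with
  | last =>
    induction j using Fin.lastCases with
    | last => simp [eps_last]
    | cast j => simp [eta_comm (L (Pi.single (Fin.last n) 1)), (hM j).2,
        (Fin.castSucc_ne_last j).symm]
  | cast i =>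
    induction j using Fin.lastCases with
    | last => simp [(hM i).2, Fin.castSucc_ne_last]
    | cast j =>
      rcases eq_or_ne i j with rfl | hij
      · simp [(hM i).1, eps_castSucc]
      · have hnull := hL ((5 : ℝ) • Pi.single (Fin.last n) 1 + (3 : ℝ) • Pi.single i.castSucc 1 +
          (4 : ℝ) • Pi.single j.castSucc 1) (by
            simp [eta_smul_left, eta_smul_right, eta_add_left, eta_add_right, eta_single_single,
              eps_last, eps_castSucc, Fin.castSucc_ne_last, (Fin.castSucc_ne_last _).symm, hij,
              hij.symm]
            norm_num)
        simp only [map_add, map_smul, eta_add_left, eta_add_right, eta_smul_left, eta_smul_right,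
          eta_comm (L (Pi.single (Fin.last n) 1)), hM,
          eta_comm (L (Pi.single j.castSucc 1)) (L (Pi.single i.castSucc 1))] at hnull
        simp only [Fin.castSucc_inj, hij, if_false, mul_zero]
        linarith

lemma sum_eps_mul_map_single (L : (Fin (n + 1) → ℝ) →L[ℝ] (Fin (n + 1) → ℝ)) {c : ℝ} (hc : c ≠ 0)
    (hL : ∀ i j, eta n (L (Pi.single i 1)) (L (Pi.single j 1)) = c * (if i = j then eps n i else 0))
    (k l : Fin (n + 1)) :
    ∑ i, eps n i * L (Pi.single i 1) k * L (Pi.single i 1) l =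
      c * (if k = l then eps n k else 0) := by
  let A : Matrix (Fin (n + 1)) (Fin (n + 1)) ℝ := Matrix.of fun k i => L (Pi.single i 1) k
  have hA : Aᵀ * etaM n * A = c • etaM n := by
    ext i j
    have := hL i j
    simp only [eta] at this
    rw [etaM, Matrix.mul_apply]
    simp only [Matrix.mul_diagonal, Matrix.transpose_apply,
      Matrix.smul_apply, Matrix.diagonal_apply, smul_eq_mul, A, Matrix.of_apply]
    rw [← this]
    exact Finset.sum_congr rfl fun _ _ => by ring
  have hE : etaM n * etaM n = 1 := by
    rw [etaM, Matrix.diagonal_mul_diagonal, ← Matrix.diagonal_one]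
    congr 1
    ext i
    by_cases hi : i = Fin.last n <;> simp [eps, hi]
  have h1 : (c⁻¹ • (etaM n * Aᵀ * etaM n)) * A = 1 := by
    rw [Matrix.smul_mul, Matrix.mul_assoc, Matrix.mul_assoc, ← Matrix.mul_assoc Aᵀ, hA,
      Matrix.mul_smul, hE, inv_smul_smul₀ hc]
  have h2 := mul_eq_one_comm.1 h1
  have h3 : A * etaM n * Aᵀ = c • etaM n := by
    rw [Matrix.mul_smul, inv_smul_eq_iff₀ hc] at h2
    have := congrArg (· * etaM n) h2
    simpa only [Matrix.mul_assoc, hE, Matrix.mul_one, Matrix.smul_mul, Matrix.one_mul] using this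
  have h4 := congrFun (congrFun h3 k) l
  rw [etaM, Matrix.mul_apply] at h4
  simp only [Matrix.mul_diagonal, Matrix.transpose_apply,
    Matrix.smul_apply, Matrix.diagonal_apply, smul_eq_mul, A, Matrix.of_apply] at h4
  rw [← h4]
  exact Finset.sum_congr rfl fun _ _ => by ring

end Conformal

section Wave

variable {n : ℕ}

lemma pd_comp_affine (L : (Fin (n + 1) → ℝ) →L[ℝ] (Fin (n + 1) → ℝ)) (b : Fin (n + 1) → ℝ)
    {f : (Fin (n + 1) → ℝ) → ℝ} (hf : Differentiable ℝ f) (i : Fin (n + 1)) (x : Fin (n + 1) → ℝ) :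
    pd n (fun z => f (L z + b)) i x = ∑ k, L (Pi.single i 1) k * pd n f k (L x + b) := by
  have hd : HasFDerivAt (fun z => f (L z + b)) ((fderiv ℝ f (L x + b)).comp L) x :=
    (hf _).hasFDerivAt.comp x (L.hasFDerivAt.add_const b)
  rw [pd, hd.fderiv, ContinuousLinearMap.comp_apply]
  conv_lhs => rw [pi_eq_sum_univ' (L (Pi.single i 1))]
  simp [pd]

lemma differentiable_pd {f : (Fin (n + 1) → ℝ) → ℝ} (hf : ContDiff ℝ (⊤ : ℕ∞) f)
    (i : Fin (n + 1)) : Differentiable ℝ (pd n f i) := by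
  have : Differentiable ℝ (fderiv ℝ f) :=
    (hf.fderiv_right (m := 1) (by norm_cast)).differentiable (by norm_num)
  exact this.clm_apply (differentiable_const _)

lemma waveOp_comp_affine (L : (Fin (n + 1) → ℝ) →L[ℝ] (Fin (n + 1) → ℝ)) (b : Fin (n + 1) → ℝ)
    {c : ℝ} (hL : ∀ k l, ∑ i, eps n i * L (Pi.single i 1) k * L (Pi.single i 1) l =
      c * (if k = l then eps n k else 0))
    {f : (Fin (n + 1) → ℝ) → ℝ} (hf : ContDiff ℝ (⊤ : ℕ∞) f) (x : Fin (n + 1) → ℝ) :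
    waveOp n (fun z => f (L z + b)) x = c * waveOp n f (L x + b) := by
  have hf1 : Differentiable ℝ f := hf.differentiable (by simp)
  have hpd : ∀ i, pd n (fun z => f (L z + b)) i =
      fun z => ∑ k, L (Pi.single i 1) k * pd n f k (L z + b) :=
    fun i => funext (pd_comp_affine L b hf1 i)
  have hpd2 : ∀ i, pd n (pd n (fun z => f (L z + b)) i) i x =
      ∑ k, L (Pi.single i 1) k * ∑ l, L (Pi.single i 1) l * pd n (pd n f k) l (L x + b) := by
    intro i
    rw [hpd i, pd_comp_affine L b (f := fun y => ∑ k, L (Pi.single i 1) k * pd n f k y)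
      (Differentiable.fun_sum fun k _ => (differentiable_pd hf k).const_mul _)]
    have hsum : ∀ l y, pd n (fun y => ∑ k, L (Pi.single i 1) k * pd n f k y) l y =
        ∑ k, L (Pi.single i 1) k * pd n (pd n f k) l y := by
      intro l y
      have hd := HasFDerivAt.fun_sum (u := Finset.univ) fun k _ =>
        ((differentiable_pd hf k y).hasFDerivAt.const_mul (L (Pi.single i 1) k))
      rw [pd, hd.fderiv]
      simp [pd]
    simp only [hsum, Finset.mul_sum]
    rw [Finset.sum_comm]
    exact Finset.sum_congr rfl fun _ _ => Finset.sum_congr rfl fun _ _ => by ring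
  calc waveOp n (fun z => f (L z + b)) x
      = ∑ k, ∑ l, (∑ i, eps n i * L (Pi.single i 1) k * L (Pi.single i 1) l) *
          pd n (pd n f k) l (L x + b) := by
        simp only [waveOp, hpd2, Finset.mul_sum, Finset.sum_mul]
        rw [Finset.sum_comm]
        refine Finset.sum_congr rfl fun k _ => ?_
        rw [Finset.sum_comm]
        exact Finset.sum_congr rfl fun _ _ => Finset.sum_congr rfl fun _ _ => by ring
    _ = c * waveOp n f (L x + b) := by
        simp only [hL, waveOp, Finset.mul_sum]
        exact Finset.sum_congr rfl fun k _ => by simp [mul_assoc]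

end Wave

/-- A causal automorphism of Minkowski spacetime (`n ≥ 2`) which is a smooth diffeomorphism
has `∂y_{n+1}/∂x_{n+1} > 0` everywhere and transforms solutions of the wave equation exactly
to solutions of the wave equation. -/
theorem causal_auto_implies_wave_preserving (n : ℕ) (hn : 2 ≤ n)
    (F G : (Fin (n + 1) → ℝ) → (Fin (n + 1) → ℝ))
    (hF : ContDiff ℝ (⊤ : ℕ∞) F) (hG : ContDiff ℝ (⊤ : ℕ∞) G)
    (hGF : Function.LeftInverse G F) (hFG : Function.RightInverse G F)
    (hCA : IsCausalAuto n F) :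
    (∀ x, 0 < pd n (fun z => F z (Fin.last n)) (Fin.last n) x) ∧
    (∀ ψ : (Fin (n + 1) → ℝ) → ℝ, ContDiff ℝ (⊤ : ℕ∞) ψ →
      ((∀ x, waveOp n (ψ ∘ F) x = 0) ↔ (∀ x, waveOp n ψ x = 0))) := by
  let Φ : (Fin (n + 1) → ℝ) ≃ₜ (Fin (n + 1) → ℝ) :=
    { toFun := F, invFun := G, left_inv := hGF, right_inv := hFG
      continuous_toFun := hF.continuous, continuous_invFun := hG.continuous }
  have h : ∀ x y, causalLe n x y ↔ causalLe n (Φ x) (Φ y) := hCA.2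
  obtain ⟨L, hL⟩ := exists_affine hn h
  have hFL : F = fun x => L x + Φ 0 := funext hL
  have hdiff : ∀ v, Φ v - Φ 0 = L v := fun v => by rw [hL v, add_sub_cancel_right]
  have hnull : ∀ v, eta n (L v) (L v) = 0 ↔ eta n v v = 0 := fun v => by
    simpa [hdiff] using eta_map_eq_zero_iff h (x := 0) (y := v)
  have hlast0 : eta n (L (Pi.single (Fin.last n) 1)) (L (Pi.single (Fin.last n) 1)) ≠ 0 := by
    rw [Ne, hnull]
    simp [eta_single_single, eps_last]
  constructor
  · intro x
    have hd : HasFDerivAt (fun z => F z (Fin.last n))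
        ((ContinuousLinearMap.proj (Fin.last n)).comp L) x := by
      rw [hFL]
      exact (ContinuousLinearMap.proj (R := ℝ) (φ := fun _ : Fin (n + 1) => ℝ)
        (Fin.last n)).hasFDerivAt.comp x (L.hasFDerivAt.add_const (Φ 0))
    rw [pd, hd.fderiv]
    change 0 < L (Pi.single (Fin.last n) 1) (Fin.last n)
    have hle := (h 0 (Pi.single (Fin.last n) 1)).1
      ⟨by simp [eta_single_single, eps_last], by simp⟩
    have hle1 := hle.1
    have hle2 := sub_nonneg.2 hle.2
    rw [← Pi.sub_apply, hdiff] at hle2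
    rw [hdiff] at hle1
    refine lt_of_le_of_ne hle2 fun h0 => hlast0 ?_
    rw [eq_zero_of_eta_self_nonpos hle1 h0.symm, eta_zero_left]
  · intro ψ hψ
    have hw : ∀ x, waveOp n (ψ ∘ F) x =
        -eta n (L (Pi.single (Fin.last n) 1)) (L (Pi.single (Fin.last n) 1)) *
          waveOp n ψ (F x) := by
      rw [hFL]
      exact waveOp_comp_affine L (Φ 0) (sum_eps_mul_map_single L (neg_ne_zero.2 hlast0)
        (eta_map_single L fun v => (hnull v).2)) hψ
    simp only [hw, mul_eq_zero, neg_eq_zero, hlast0, false_or]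
    exact (hFG.surjective.forall (p := fun y => waveOp n ψ y = 0)).symm
end
end

section
/- Let n ≥ 2 and let F : ℝ^{n+1} → ℝ^{n+1} be a smooth diffeomorphism, written y = F(x) with components y_1, …, y_{n+1}. Assume that ∂y_{n+1}/∂x_{n+1} ≥ 0 at every point, and that for every smooth function ψ : ℝ^{n+1} → ℝ, □(ψ∘F) = 0 on ℝ^{n+1} if and only if □ψ = 0 on ℝ^{n+1}. Then F is a causal automorphism of (n+1)-dimensional Minkowski spacetime. -/
open scoped BigOperators
open Matrix

noncomputable section

lemma eps_mul_self (n : ℕ) (i : Fin (n + 1)) : eps n i * eps n i = 1 := by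
  unfold eps; split_ifs <;> norm_num

lemma etaM_mul_self (n : ℕ) : etaM n * etaM n = 1 := by
  simp [etaM, Matrix.diagonal_mul_diagonal, eps_mul_self]

/-- The Minkowski form splits into its spatial and temporal parts. -/
lemma eta_eq_sum_castSucc (n : ℕ) (u v : Fin (n + 1) → ℝ) :
    eta n u v = ∑ i : Fin n, u i.castSucc * v i.castSucc - u (Fin.last n) * v (Fin.last n) := by
  simp [eta, Fin.sum_univ_castSucc, eps, sub_eq_add_neg]

lemma pd_add {n : ℕ} {f g : (Fin (n + 1) → ℝ) → ℝ} (hf : Differentiable ℝ f)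
    (hg : Differentiable ℝ g) (i : Fin (n + 1)) :
    pd n (fun x => f x + g x) i = fun x => pd n f i x + pd n g i x := by
  funext x
  simp [pd, fderiv_fun_add (hf x) (hg x)]

lemma pd_const_mul {n : ℕ} {f : (Fin (n + 1) → ℝ) → ℝ} (hf : Differentiable ℝ f) (c : ℝ)
    (i : Fin (n + 1)) : pd n (fun x => c * f x) i = fun x => c * pd n f i x := by
  funext x
  simp [pd, fderiv_const_mul (hf x)]

lemma pd_mul {n : ℕ} {f g : (Fin (n + 1) → ℝ) → ℝ} (hf : Differentiable ℝ f)
    (hg : Differentiable ℝ g) (i : Fin (n + 1)) :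
    pd n (fun x => f x * g x) i = fun x => f x * pd n g i x + g x * pd n f i x := by
  funext x
  simp [pd, fderiv_fun_mul (hf x) (hg x)]

lemma pd_sum {n : ℕ} {ι : Type*} (s : Finset ι) {f : ι → (Fin (n + 1) → ℝ) → ℝ}
    (hf : ∀ k, Differentiable ℝ (f k)) (i : Fin (n + 1)) :
    pd n (fun x => ∑ k ∈ s, f k x) i = fun x => ∑ k ∈ s, pd n (f k) i x := by
  funext x
  simp [pd, fderiv_fun_sum (fun k _ => hf k x)]

lemma ContDiff.differentiable_infty {n : ℕ} {f : (Fin (n + 1) → ℝ) → ℝ}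
    (hf : ContDiff ℝ (⊤ : ℕ∞) f) : Differentiable ℝ f :=
  hf.differentiable (by simp)

lemma ContDiff.pd {n : ℕ} {f : (Fin (n + 1) → ℝ) → ℝ} (hf : ContDiff ℝ (⊤ : ℕ∞) f)
    (i : Fin (n + 1)) : ContDiff ℝ (⊤ : ℕ∞) (pd n f i) :=
  (hf.fderiv_right (m := (⊤ : ℕ∞)) (by simp)).clm_apply contDiff_const

lemma pd_comm {n : ℕ} {f : (Fin (n + 1) → ℝ) → ℝ} (hf : ContDiff ℝ (⊤ : ℕ∞) f)
    (i j : Fin (n + 1)) (x : Fin (n + 1) → ℝ) : pd n (pd n f i) j x = pd n (pd n f j) i x := by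
  have hd : Differentiable ℝ (fderiv ℝ f) :=
    (hf.fderiv_right (m := (⊤ : ℕ∞)) (by simp)).differentiable (by simp)
  have key : ∀ i j, pd n (pd n f i) j x =
      fderiv ℝ (fderiv ℝ f) x (Pi.single j 1) (Pi.single i 1) := fun i j => by
    have h := fderiv_clm_apply (hd x) (differentiableAt_const (Pi.single i (1 : ℝ)))
    change fderiv ℝ (fun y => fderiv ℝ f y (Pi.single i 1)) x (Pi.single j 1) = _
    rw [h]
    simp
  rw [key, key]
  exact (hf.contDiffAt.isSymmSndFDerivAt (by
    rw [minSmoothness_of_isRCLikeNormedField]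
    exact WithTop.coe_le_coe.2 (le_top : (2 : ℕ∞) ≤ ⊤))).eq _ _

lemma fderiv_apply_eq_sum_pd {n : ℕ} (f : (Fin (n + 1) → ℝ) → ℝ) (x v : Fin (n + 1) → ℝ) :
    fderiv ℝ f x v = ∑ i, v i * pd n f i x := by
  conv_lhs => rw [pi_eq_sum_univ' v]
  simp [pd]

lemma waveOp_add {n : ℕ} {f g : (Fin (n + 1) → ℝ) → ℝ} (hf : ContDiff ℝ (⊤ : ℕ∞) f)
    (hg : ContDiff ℝ (⊤ : ℕ∞) g) (x : Fin (n + 1) → ℝ) :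
    waveOp n (fun x => f x + g x) x = waveOp n f x + waveOp n g x := by
  simp only [waveOp, pd_add hf.differentiable_infty hg.differentiable_infty,
    pd_add (hf.pd _).differentiable_infty (hg.pd _).differentiable_infty, mul_add,
    Finset.sum_add_distrib]

lemma waveOp_const_mul {n : ℕ} {f : (Fin (n + 1) → ℝ) → ℝ} (hf : ContDiff ℝ (⊤ : ℕ∞) f)
    (c : ℝ) (x : Fin (n + 1) → ℝ) : waveOp n (fun x => c * f x) x = c * waveOp n f x := by
  simp only [waveOp, pd_const_mul hf.differentiable_infty,
    pd_const_mul (hf.pd _).differentiable_infty, Finset.mul_sum]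
  exact Finset.sum_congr rfl fun i _ => by ring

lemma waveOp_mul {n : ℕ} {f g : (Fin (n + 1) → ℝ) → ℝ} (hf : ContDiff ℝ (⊤ : ℕ∞) f)
    (hg : ContDiff ℝ (⊤ : ℕ∞) g) (x : Fin (n + 1) → ℝ) :
    waveOp n (fun x => f x * g x) x = f x * waveOp n g x + g x * waveOp n f x +
      2 * eta n (fun i => pd n f i x) (fun i => pd n g i x) := by
  have hf' := hf.differentiable_infty
  have hg' := hg.differentiable_infty
  have hfi := fun i => (hf.pd i).differentiable_infty
  have hgi := fun i => (hg.pd i).differentiable_infty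
  simp only [waveOp, eta, pd_mul hf' hg',
    pd_add (hf'.fun_mul (hgi _)) (hg'.fun_mul (hfi _)),
    pd_mul hf' (hgi _), pd_mul hg' (hfi _), Finset.mul_sum, ← Finset.sum_add_distrib]
  exact Finset.sum_congr rfl fun i _ => by ring

lemma contDiff_coord {n : ℕ} (k : Fin (n + 1)) :
    ContDiff ℝ (⊤ : ℕ∞) (fun z : Fin (n + 1) → ℝ => z k) := contDiff_apply ℝ ℝ k

lemma pd_coord {n : ℕ} (k i : Fin (n + 1)) :
    pd n (fun z => z k) i = fun _ => if i = k then 1 else 0 := by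
  funext x
  simp [pd, fderiv_apply, Pi.single_apply, eq_comm]

lemma waveOp_coord {n : ℕ} (k : Fin (n + 1)) (x : Fin (n + 1) → ℝ) :
    waveOp n (fun z => z k) x = 0 := by
  simp only [waveOp, pd_coord]
  simp [pd]

lemma waveOp_coord_mul {n : ℕ} (k l : Fin (n + 1)) (x : Fin (n + 1) → ℝ) :
    waveOp n (fun z => z k * z l) x = 2 * if k = l then eps n k else 0 := by
  rw [waveOp_mul (contDiff_coord k) (contDiff_coord l), waveOp_coord, waveOp_coord]
  rcases eq_or_ne k l with rfl | h
  · simp [pd_coord, eta]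
  · simp [pd_coord, eta, h, h.symm]

/-- A map pulling solutions of the wave equation back to solutions has components which solve the
wave equation, and its Jacobian is pointwise conformal for the Minkowski form. -/
lemma conformal_of_waveOp_comp {n : ℕ} {F : (Fin (n + 1) → ℝ) → (Fin (n + 1) → ℝ)}
    (hF : ContDiff ℝ (⊤ : ℕ∞) F)
    (hwave : ∀ ψ : (Fin (n + 1) → ℝ) → ℝ, ContDiff ℝ (⊤ : ℕ∞) ψ →
      (∀ x, waveOp n ψ x = 0) → ∀ x, waveOp n (ψ ∘ F) x = 0) :
    (∀ k x, waveOp n (fun z => F z k) x = 0) ∧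
    ∀ k l x, eta n (jacRow n F k x) (jacRow n F l x) =
      eps n 0 * eta n (jacRow n F 0 x) (jacRow n F 0 x) * if k = l then eps n k else 0 := by
  have hc : ∀ k, ContDiff ℝ (⊤ : ℕ∞) (fun z => F z k) := contDiff_pi.1 hF
  have h1 : ∀ k x, waveOp n (fun z => F z k) x = 0 := fun k =>
    hwave (fun z => z k) (contDiff_coord k) (waveOp_coord k)
  have hmul : ∀ k l x, waveOp n (fun z => F z k * F z l) x =
      2 * eta n (jacRow n F k x) (jacRow n F l x) := fun k l x => by
    rw [waveOp_mul (hc k) (hc l), h1, h1]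
    simp only [mul_zero, zero_add]
    rfl
  refine ⟨h1, fun k l x => ?_⟩
  rcases eq_or_ne k l with rfl | hkl
  · have h := hwave (fun z => eps n k * (z k * z k) + -eps n 0 * (z 0 * z 0))
      ((contDiff_const.mul ((contDiff_coord k).mul (contDiff_coord k))).add
        (contDiff_const.mul ((contDiff_coord 0).mul (contDiff_coord 0))))
      (fun x => by
        rw [waveOp_add (contDiff_const.mul ((contDiff_coord k).mul (contDiff_coord k)))
          (contDiff_const.mul ((contDiff_coord 0).mul (contDiff_coord 0))),
          waveOp_const_mul ((contDiff_coord k).mul (contDiff_coord k)),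
          waveOp_const_mul ((contDiff_coord 0).mul (contDiff_coord 0)),
          waveOp_coord_mul, waveOp_coord_mul]
        simp only [if_true]
        linear_combination 2 * eps_mul_self n k - 2 * eps_mul_self n 0) x
    change waveOp n (fun z => eps n k * (F z k * F z k) + -eps n 0 * (F z 0 * F z 0)) x = 0 at h
    rw [waveOp_add (contDiff_const.mul ((hc k).mul (hc k)))
        (contDiff_const.mul ((hc 0).mul (hc 0))),
      waveOp_const_mul ((hc k).mul (hc k)), waveOp_const_mul ((hc 0).mul (hc 0)),
      hmul, hmul] at h
    rw [if_pos rfl]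
    linear_combination eps n k * h / 2 -
      eta n (jacRow n F k x) (jacRow n F k x) * eps_mul_self n k
  · have h := hwave (fun z => z k * z l) ((contDiff_coord k).mul (contDiff_coord l))
      (fun x => by rw [waveOp_coord_mul, if_neg hkl, mul_zero]) x
    change waveOp n (fun z => F z k * F z l) x = 0 at h
    rw [hmul] at h
    rw [if_neg hkl]
    linarith

/-- The transpose of a conformal Lorentz matrix is conformal, with the same nonzero factor. -/
lemma transpose_conformal {n : ℕ} {A B : Matrix (Fin (n + 1)) (Fin (n + 1)) ℝ} (hAB : B * A = 1)
    {c : ℝ} (h : A * etaM n * Aᵀ = c • etaM n) : c ≠ 0 ∧ Aᵀ * etaM n * A = c • etaM n := by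
  have hc : c ≠ 0 := by
    rintro rfl
    have hT : Aᵀ * Bᵀ = 1 := by rw [← Matrix.transpose_mul, hAB, Matrix.transpose_one]
    have h0 : etaM n = B * (A * etaM n * Aᵀ) * Bᵀ := by
      calc etaM n = (B * A) * etaM n * (Aᵀ * Bᵀ) := by rw [hAB, hT]; simp
        _ = _ := by simp only [Matrix.mul_assoc]
    have h2 := etaM_mul_self n
    rw [h0, h] at h2
    simp at h2
  refine ⟨hc, ?_⟩
  have h1 : A * (c⁻¹ • (etaM n * Aᵀ * etaM n)) = 1 := by
    rw [Matrix.mul_smul, ← Matrix.mul_assoc, ← Matrix.mul_assoc, h, Matrix.smul_mul,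
      etaM_mul_self, smul_smul, inv_mul_cancel₀ hc, one_smul]
  have h2 := mul_eq_one_comm.1 h1
  calc Aᵀ * etaM n * A = (etaM n * etaM n) * (Aᵀ * etaM n * A) := by
        rw [etaM_mul_self, one_mul]
    _ = c • (etaM n * ((c⁻¹ • (etaM n * Aᵀ * etaM n)) * A)) := by
        rw [Matrix.smul_mul, Matrix.mul_smul, smul_smul, mul_inv_cancel₀ hc, one_smul]
        simp only [Matrix.mul_assoc]
    _ = c • etaM n := by rw [h2, mul_one]

/-- The Jacobian matrix of a map with a differentiable left inverse is invertible. -/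
lemma exists_mul_jacobian_eq_one {n : ℕ} {F G : (Fin (n + 1) → ℝ) → (Fin (n + 1) → ℝ)}
    (hF : Differentiable ℝ F) (hG : Differentiable ℝ G) (hGF : Function.LeftInverse G F)
    (x : Fin (n + 1) → ℝ) :
    ∃ B : Matrix (Fin (n + 1)) (Fin (n + 1)) ℝ,
      B * Matrix.of (fun k i => jacRow n F k x i) = 1 := by
  have hA : Matrix.of (fun k i => jacRow n F k x i) =
      LinearMap.toMatrix' (fderiv ℝ F x : (Fin (n + 1) → ℝ) →ₗ[ℝ] (Fin (n + 1) → ℝ)) := by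
    ext k i
    have h : fderiv ℝ (fun z => F z k) x = _ :=
      (hasFDerivAt_pi'.1 (hF x).hasFDerivAt k).fderiv
    simp [jacRow, pd, h, LinearMap.toMatrix'_apply]
  refine ⟨LinearMap.toMatrix'
    (fderiv ℝ G (F x) : (Fin (n + 1) → ℝ) →ₗ[ℝ] (Fin (n + 1) → ℝ)), ?_⟩
  have hcomp : (fderiv ℝ G (F x)).comp (fderiv ℝ F x) = ContinuousLinearMap.id ℝ _ := by
    rw [← fderiv_comp x (hG (F x)) (hF x), hGF.comp_eq_id, fderiv_id]
  rw [hA, ← LinearMap.toMatrix'_comp, ← ContinuousLinearMap.toLinearMap_comp, hcomp]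
  simp

/-- A tensor antisymmetric in its first two slots and symmetric in its last two vanishes. -/
lemma eq_zero_of_antisymm_of_symm {ι : Type*} {T : ι → ι → ι → ℝ}
    (hanti : ∀ i j l, T i j l + T j i l = 0) (hsymm : ∀ i j l, T i j l = T i l j)
    (i j l : ι) : T i j l = 0 := by
  linarith [hanti i j l, hsymm j i l, hanti j l i, hsymm l j i, hanti l i j, hsymm i l j]

/-- In dimension at least three, a conformal diffeomorphism whose components solve the wave
equation has vanishing second derivatives. -/
lemma pd_pd_eq_zero_of_conformal {n : ℕ} (hn : 2 ≤ n)
    {F : (Fin (n + 1) → ℝ) → (Fin (n + 1) → ℝ)} (hF : ContDiff ℝ (⊤ : ℕ∞) F)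
    {c : (Fin (n + 1) → ℝ) → ℝ} (hc : Differentiable ℝ c) (hc0 : ∀ x, c x ≠ 0)
    (hbox : ∀ k x, waveOp n (fun z => F z k) x = 0)
    (hrow : ∀ k l x, eta n (jacRow n F k x) (jacRow n F l x) = c x * if k = l then eps n k else 0)
    (hcol : ∀ i j x, ∑ k, eps n k * (jacRow n F k x i * jacRow n F k x j) =
      c x * if i = j then eps n i else 0)
    (k j l : Fin (n + 1)) (x : Fin (n + 1) → ℝ) :
    pd n (fun z => jacRow n F k z j) l x = 0 := by
  have hcF : ∀ k, ContDiff ℝ (⊤ : ℕ∞) (fun z => F z k) := contDiff_pi.1 hF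
  have ha : ∀ k i, Differentiable ℝ (fun z => jacRow n F k z i) := fun k i =>
    ((hcF k).pd i).differentiable_infty
  set b : Fin (n + 1) → Fin (n + 1) → Fin (n + 1) → ℝ :=
    fun k i j => pd n (fun z => jacRow n F k z i) j x
  have hbs : ∀ k i j, b k i j = b k j i := fun k i j => pd_comm (hcF k) i j x
  have hE : ∀ i j l, ∑ k, eps n k * (jacRow n F k x i * b k j l + jacRow n F k x j * b k i l) =
      pd n c l x * if i = j then eps n i else 0 := fun i j l => by
    have h := congrArg (fun f => pd n f l x) (funext (hcol i j))
    simp only [pd_sum Finset.univ (fun k => ((ha k i).fun_mul (ha k j)).const_mul (eps n k)),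
      pd_const_mul ((ha _ i).fun_mul (ha _ j)), pd_mul (ha _ i) (ha _ j)] at h
    rw [h]
    have h2 := congrFun (pd_const_mul hc (if i = j then eps n i else 0) l) x
    simp only [mul_comm (c _)]
    rw [h2, mul_comm]
  have hdc : ∀ j, pd n c j x = 0 := fun j => by
    have hb0 : ∀ k, ∑ i, eps n i * b k i i = 0 := fun k => hbox k x
    have h1 : ∑ i, eps n i * ∑ k, eps n k * (jacRow n F k x i * b k i j) = pd n c j x := by
      have h := Finset.sum_congr rfl fun i (_ : i ∈ Finset.univ) =>
        congrArg (eps n i * ·) (hE i j i)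
      have h2 : ∑ i, eps n i * (pd n c i x * if i = j then eps n i else 0) = pd n c j x := by
        simp only [mul_ite, mul_zero, Finset.sum_ite_eq', Finset.mem_univ, if_true]
        linear_combination pd n c j x * eps_mul_self n j
      have h3 : ∑ i, eps n i * ∑ k, eps n k * (jacRow n F k x j * b k i i) = 0 := by
        simp only [Finset.mul_sum]
        rw [Finset.sum_comm]
        refine Finset.sum_eq_zero fun k _ => ?_
        have h4 := congrArg (eps n k * jacRow n F k x j * ·) (hb0 k)
        simp only [Finset.mul_sum, mul_zero] at h4
        rw [← h4]
        exact Finset.sum_congr rfl fun i _ => by ring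
      rw [h2] at h
      simp only [mul_add, Finset.sum_add_distrib, h3, add_zero] at h
      rw [← h]
      simp only [hbs _ j]
    have h2 : ∑ i, eps n i * ∑ k, eps n k * (jacRow n F k x i * b k i j) =
        (n + 1) * pd n c j x / 2 := by
      have h := Finset.sum_congr rfl fun i (_ : i ∈ Finset.univ) =>
        congrArg (eps n i * · / 2) (hE i i j)
      have h3 : ∀ i, eps n i * (pd n c j x * eps n i) / 2 = pd n c j x / 2 := fun i => by
        linear_combination pd n c j x / 2 * eps_mul_self n i
      simp only [if_true, h3, Finset.sum_const, Finset.card_univ, Fintype.card_fin,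
        nsmul_eq_mul] at h
      push_cast at h
      rw [mul_div_assoc, ← h]
      refine Finset.sum_congr rfl fun i _ => ?_
      rw [mul_div_assoc, Finset.sum_div]
      congr 1
      exact Finset.sum_congr rfl fun k _ => by ring
    have hn' : (2 : ℝ) ≤ n := by exact_mod_cast hn
    have h3 : ((n : ℝ) - 1) * pd n c j x = 0 := by linarith
    exact (mul_eq_zero.1 h3).resolve_left (by linarith)
  have hT := eq_zero_of_antisymm_of_symm
    (T := fun i j l => ∑ k, eps n k * (jacRow n F k x i * b k j l))
    (fun i j l => by
      have h := hE i j l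
      rw [hdc, zero_mul] at h
      simpa only [mul_add, Finset.sum_add_distrib] using h)
    (fun i j l => by simp only [hbs _ j l])
  have hz : c x * b k j l = 0 := by
    calc c x * b k j l = ∑ m, eps n m * b m j l * eta n (jacRow n F k x) (jacRow n F m x) := by
          simp only [hrow, mul_ite, mul_zero, Finset.sum_ite_eq, Finset.mem_univ, if_true]
          linear_combination -(c x * b k j l) * eps_mul_self n k
      _ = ∑ i, eps n i * jacRow n F k x i *
            ∑ m, eps n m * (jacRow n F m x i * b m j l) := by
          simp only [eta, Finset.mul_sum]
          rw [Finset.sum_comm]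
          exact Finset.sum_congr rfl fun i _ => Finset.sum_congr rfl fun m _ => by ring
      _ = 0 := Finset.sum_eq_zero fun i _ => by
          have h := hT i j l
          rw [h, mul_zero]
  exact (mul_eq_zero.1 hz).resolve_left (hc0 x)

/-- Two timelike vectors are never orthogonal. -/
lemma eta_ne_zero_of_timelike {n : ℕ} {u v : Fin (n + 1) → ℝ} (hu : eta n u u < 0)
    (hv : eta n v v < 0) : eta n u v ≠ 0 := by
  intro huv
  rw [eta_eq_sum_castSucc] at hu hv huv
  have h := Finset.sum_mul_sq_le_sq_mul_sq Finset.univ (fun i : Fin n => u i.castSucc)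
    (fun i => v i.castSucc)
  simp only [pow_two] at h
  have h1 : 0 ≤ ∑ i : Fin n, u i.castSucc * u i.castSucc :=
    Finset.sum_nonneg fun i _ => mul_self_nonneg _
  have h2 : 0 ≤ ∑ i : Fin n, v i.castSucc * v i.castSucc :=
    Finset.sum_nonneg fun i _ => mul_self_nonneg _
  rw [sub_eq_zero.1 huv] at h
  nlinarith

/-- A future-directed timelike covector is nonnegative exactly on the future-directed causal
vectors, among the causal vectors. -/
lemma sum_mul_nonneg_iff_of_timelike {n : ℕ} {u v : Fin (n + 1) → ℝ} (hu : eta n u u < 0)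
    (hu0 : 0 ≤ u (Fin.last n)) (hv : eta n v v ≤ 0) :
    0 ≤ ∑ i, u i * v i ↔ 0 ≤ v (Fin.last n) := by
  rw [eta_eq_sum_castSucc] at hu hv
  have h := Finset.sum_mul_sq_le_sq_mul_sq Finset.univ (fun i : Fin n => u i.castSucc)
    (fun i => v i.castSucc)
  simp only [pow_two] at h
  have h1 : 0 ≤ ∑ i : Fin n, u i.castSucc * u i.castSucc :=
    Finset.sum_nonneg fun i _ => mul_self_nonneg _
  have h2 : 0 ≤ ∑ i : Fin n, v i.castSucc * v i.castSucc :=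
    Finset.sum_nonneg fun i _ => mul_self_nonneg _
  rw [Fin.sum_univ_castSucc]
  generalize ∑ i : Fin n, u i.castSucc * u i.castSucc = p at *
  generalize ∑ i : Fin n, v i.castSucc * v i.castSucc = q at *
  generalize ∑ i : Fin n, u i.castSucc * v i.castSucc = s at *
  generalize u (Fin.last n) = a at *
  generalize v (Fin.last n) = t at *
  have hs : s * s ≤ (a * t) * (a * t) := by nlinarith [mul_self_nonneg t]
  have ha : 0 < a := lt_of_le_of_ne hu0 fun h => by subst h; linarith
  constructor
  · intro h0
    by_contra! ht
    have hat : a * t < 0 := mul_neg_of_pos_of_neg ha ht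
    have hlt : s * s < (a * t) * (a * t) := by
      nlinarith [mul_pos_of_neg_of_neg ht ht]
    nlinarith
  · intro ht
    have := abs_le_of_sq_le_sq' (by nlinarith : s ^ 2 ≤ (a * t) ^ 2) (mul_nonneg ha.le ht)
    linarith [this.1]

/-- A smooth map with vanishing second derivatives is affine. -/
lemma sub_eq_sum_jacRow {n : ℕ} {F : (Fin (n + 1) → ℝ) → (Fin (n + 1) → ℝ)}
    (hF : ContDiff ℝ (⊤ : ℕ∞) F)
    (h : ∀ k j l x, pd n (fun z => jacRow n F k z j) l x = 0) (x y : Fin (n + 1) → ℝ)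
    (k : Fin (n + 1)) : F y k - F x k = ∑ i, jacRow n F k 0 i * (y - x) i := by
  have hcF : ∀ k, ContDiff ℝ (⊤ : ℕ∞) (fun z => F z k) := contDiff_pi.1 hF
  have hconst : ∀ i z, pd n (fun z => F z k) i z = jacRow n F k 0 i := fun i z =>
    is_const_of_fderiv_eq_zero (𝕜 := ℝ) ((hcF k).pd i).differentiable_infty
      (fun w => by
        ext v
        rw [fderiv_apply_eq_sum_pd]
        exact Finset.sum_eq_zero fun l _ => by
          rw [show pd n (pd n (fun z => F z k) i) l w = 0 from h k i l w, mul_zero]) z 0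
  have hder : ∀ z, fderiv ℝ (fun z => F z k) z = fderiv ℝ (fun z => F z k) 0 := fun z => by
    ext v
    rw [fderiv_apply_eq_sum_pd, fderiv_apply_eq_sum_pd]
    simp only [hconst]
  have hd := (hcF k).differentiable_infty
  have h0 := is_const_of_fderiv_eq_zero (𝕜 := ℝ)
    (hd.fun_sub (fderiv ℝ (fun z => F z k) 0).differentiable) (fun z => by
      rw [fderiv_fun_sub (hd z) (ContinuousLinearMap.differentiableAt _), hder z,
        ContinuousLinearMap.fderiv, sub_self]) y x
  have h1 : F y k - F x k = fderiv ℝ (fun z => F z k) 0 (y - x) := by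
    rw [map_sub]
    linarith
  rw [h1, fderiv_apply_eq_sum_pd]
  exact Finset.sum_congr rfl fun i _ => by rw [hconst, mul_comm]

/-- If a smooth diffeomorphism `F` of `ℝ^{n+1}` (with `n ≥ 2`) satisfies
`∂y_{n+1}/∂x_{n+1} ≥ 0` everywhere and transforms solutions of the wave equation exactly to
solutions of the wave equation, then `F` is a causal automorphism. -/
theorem wave_preserving_implies_causal_auto (n : ℕ) (hn : 2 ≤ n)
    (F G : (Fin (n + 1) → ℝ) → (Fin (n + 1) → ℝ))
    (hF : ContDiff ℝ (⊤ : ℕ∞) F) (hG : ContDiff ℝ (⊤ : ℕ∞) G)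
    (hGF : Function.LeftInverse G F) (hFG : Function.RightInverse G F)
    (hpos : ∀ x, 0 ≤ pd n (fun z => F z (Fin.last n)) (Fin.last n) x)
    (hwave : ∀ ψ : (Fin (n + 1) → ℝ) → ℝ, ContDiff ℝ (⊤ : ℕ∞) ψ →
      ((∀ x, waveOp n (ψ ∘ F) x = 0) ↔ (∀ x, waveOp n ψ x = 0))) :
    IsCausalAuto n F := by
  obtain ⟨hbox, hrow⟩ := conformal_of_waveOp_comp hF fun ψ hψ => (hwave ψ hψ).2
  set c : (Fin (n + 1) → ℝ) → ℝ := fun x =>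
    eps n 0 * eta n (jacRow n F 0 x) (jacRow n F 0 x) with hc
  replace hrow : ∀ k l x, eta n (jacRow n F k x) (jacRow n F l x) =
      c x * if k = l then eps n k else 0 := hrow
  have hcF : ∀ k, ContDiff ℝ (⊤ : ℕ∞) (fun z => F z k) := contDiff_pi.1 hF
  have hcd : Differentiable ℝ c := by
    have ha : ∀ i, Differentiable ℝ (fun z => jacRow n F 0 z i) := fun i =>
      ((hcF 0).pd i).differentiable_infty
    simp only [hc, eta]
    fun_prop
  have hmat : ∀ x, c x ≠ 0 ∧ ∀ i j, ∑ k, eps n k * (jacRow n F k x i * jacRow n F k x j) =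
      c x * if i = j then eps n i else 0 := fun x => by
    obtain ⟨B, hB⟩ := exists_mul_jacobian_eq_one (hF.differentiable (by simp))
      (hG.differentiable (by simp)) hGF x
    obtain ⟨h0, hT⟩ := transpose_conformal hB (c := c x) (by
      ext k l
      have h := hrow k l x
      rw [etaM, Matrix.mul_apply]
      simp only [Matrix.mul_diagonal, Matrix.smul_apply,
        Matrix.diagonal_apply, Matrix.transpose_apply, Matrix.of_apply, smul_eq_mul]
      rw [← h, eta]
      exact Finset.sum_congr rfl fun i _ => by ring)
    refine ⟨h0, fun i j => ?_⟩
    have h := congrFun (congrFun hT i) j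
    rw [etaM, Matrix.mul_apply] at h
    simp only [Matrix.mul_diagonal, Matrix.smul_apply,
      Matrix.diagonal_apply, Matrix.transpose_apply, Matrix.of_apply, smul_eq_mul] at h
    rw [← h]
    exact Finset.sum_congr rfl fun k _ => by ring
  have haff := sub_eq_sum_jacRow hF
    (pd_pd_eq_zero_of_conformal hn hF hcd (fun x => (hmat x).1) hbox hrow
      fun i j x => (hmat x).2 i j)
  have hcpos : 0 < c 0 := by
    refine lt_of_le_of_ne (not_lt.1 fun hneg => ?_) (hmat 0).1.symm
    have hs : ∀ k : Fin n, eta n (jacRow n F k.castSucc 0) (jacRow n F k.castSucc 0) < 0 :=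
        fun k => by
      rw [hrow, if_pos rfl, eps, if_neg (Fin.castSucc_lt_last k).ne, mul_one]
      exact hneg
    refine eta_ne_zero_of_timelike (hs ⟨0, by omega⟩) (hs ⟨1, by omega⟩) ?_
    rw [hrow, if_neg (by simp [Fin.ext_iff]), mul_zero]
  have heta : ∀ x y, eta n (F y - F x) (F y - F x) = c 0 * eta n (y - x) (y - x) := fun x y => by
    have hv : F y - F x = fun k => ∑ i, jacRow n F k 0 i * (y - x) i := funext (haff x y)
    rw [hv]
    generalize y - x = v
    simp only [eta]
    calc ∑ k, eps n k * (∑ i, jacRow n F k 0 i * v i) * (∑ j, jacRow n F k 0 j * v j)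
        = ∑ i, ∑ j, v i * v j * ∑ k, eps n k * (jacRow n F k 0 i * jacRow n F k 0 j) := by
          simp only [mul_assoc (eps n _), Finset.sum_mul_sum]
          simp only [Finset.mul_sum]
          rw [Finset.sum_comm]
          refine Finset.sum_congr rfl fun i _ => ?_
          rw [Finset.sum_comm]
          exact Finset.sum_congr rfl fun j _ => Finset.sum_congr rfl fun k _ => by ring
      _ = _ := by
          simp only [(hmat 0).2, mul_ite, mul_zero, Finset.sum_ite_eq, Finset.mem_univ, if_true,
            Finset.mul_sum]
          exact Finset.sum_congr rfl fun i _ => by ring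
  refine ⟨⟨hGF.injective, hFG.surjective⟩, fun x y => ?_⟩
  have htime : eta n (jacRow n F (Fin.last n) 0) (jacRow n F (Fin.last n) 0) < 0 := by
    rw [hrow, if_pos rfl, eps, if_pos rfl]
    linarith
  unfold causalLe
  rw [heta, show c 0 * eta n (y - x) (y - x) ≤ 0 ↔ eta n (y - x) (y - x) ≤ 0 from
    ⟨fun h => nonpos_of_mul_nonpos_right h hcpos, mul_nonpos_of_nonneg_of_nonpos hcpos.le⟩]
  refine and_congr_right fun hv => ?_
  have h := sum_mul_nonneg_iff_of_timelike htime (hpos 0) hv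
  rw [← haff, sub_nonneg, Pi.sub_apply, sub_nonneg] at h
  exact h.symm
end
end
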